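/- There exists a base q ∈ SI such that the symmetric q-shift (V_q, σ) does not have the specification property. Indeed, there exists q ∈ SI such that for every K ∈ ℕ there is n ∈ ℕ with d(σ^n(α(q)), ᾱ(q)) ≤ 2^{−K}. -/

import Mathlib

open Classical

/-- The one-sided shift map on sequences. -/
def shift (x : ℕ → ℕ) : ℕ → ℕ := fun i => x (i + 1)

/-- Reflection of a sequence with respect to the alphabet `{0,…,M}`. -/
def reflSeq (M : ℕ) (x : ℕ → ℕ) : ℕ → ℕ := fun i => M - x i

/-- Strict lexicographic order on sequences. -/
def lexLT (x y : ℕ → ℕ) : Prop := ∃ n : ℕ, (∀ i < n, x i = y i) ∧ x n < y n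

/-- Lexicographic order on sequences. -/
def lexLE (x y : ℕ → ℕ) : Prop := x = y ∨ lexLT x y

/-- Strict lexicographic order on words (of the same length). -/
def wordLT (u v : List ℕ) : Prop :=
  ∃ n : ℕ, n < u.length ∧ (∀ i < n, u.getD i 0 = v.getD i 0) ∧ u.getD n 0 < v.getD n 0

/-- Lexicographic order on words (of the same length). -/
def wordLE (u v : List ℕ) : Prop := u = v ∨ wordLT u v

/-- Membership in the full shift over the alphabet `{0,…,M}`. -/
def memSigma (M : ℕ) (x : ℕ → ℕ) : Prop := ∀ i, x i ≤ M

/-- `a` is the quasi-greedy expansion of `1` in base `q` over the alphabet `{0,…,M}`: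
the lexicographically largest sequence with infinitely many nonzero entries satisfying
`∑ a_i q^{-i} = 1`. -/
def IsQuasiGreedy (M : ℕ) (q : ℝ) (a : ℕ → ℕ) : Prop :=
  memSigma M a ∧ (∀ n, ∃ m ≥ n, a m ≠ 0) ∧ (∑' i : ℕ, (a i : ℝ) / q ^ (i + 1)) = 1 ∧
    ∀ b : ℕ → ℕ, memSigma M b → (∀ n, ∃ m ≥ n, b m ≠ 0) →
      (∑' i : ℕ, (b i : ℝ) / q ^ (i + 1)) = 1 → lexLE b a

/-- The quasi-greedy expansion of `1` in base `q` (as a global function, via choice). -/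
noncomputable def qg (M : ℕ) (q : ℝ) : ℕ → ℕ :=
  if h : ∃ a, IsQuasiGreedy M q a then h.choose else fun _ => 0

/-- The set `V` of sequences `a` with `ā ≼ σⁿ(a) ≼ a` for all `n ≥ 0`. -/
def memV (M : ℕ) (a : ℕ → ℕ) : Prop :=
  memSigma M a ∧ ∀ n : ℕ, lexLE (reflSeq M a) (shift^[n] a) ∧ lexLE (shift^[n] a) a

/-- The set `V_L` of bases `q ∈ (1, M+1]` with `α(q) ∈ V`. -/
def memVL (M : ℕ) (q : ℝ) : Prop := 1 < q ∧ q ≤ M + 1 ∧ memV M (qg M q)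

/-- The symmetric `q`-shift `V_q`. -/
def Vq (M : ℕ) (q : ℝ) : Set (ℕ → ℕ) :=
  {x | memSigma M x ∧
    ∀ n : ℕ, lexLE (reflSeq M (qg M q)) (shift^[n] x) ∧ lexLE (shift^[n] x) (qg M q)}

/-- The word `w` occurs as a factor of the sequence `x`. -/
def IsFactorOf (w : List ℕ) (x : ℕ → ℕ) : Prop :=
  ∃ k : ℕ, ∀ i < w.length, x (k + i) = w.getD i 0

/-- Membership in the language of a subshift `X`. -/
def InLang (X : Set (ℕ → ℕ)) (w : List ℕ) : Prop := ∃ x ∈ X, IsFactorOf w x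

/-- The set of admissible words of length `k` of a subshift `X`. -/
def Bn (X : Set (ℕ → ℕ)) (k : ℕ) : Set (List ℕ) := {w | w.length = k ∧ InLang X w}

/-- The specification property. -/
def HasSpecification (X : Set (ℕ → ℕ)) : Prop :=
  ∃ S : ℕ, ∀ u v : List ℕ, InLang X u → InLang X v →
    ∃ w : List ℕ, w.length = S ∧ InLang X (u ++ w ++ v)

/-- Topological transitivity (language formulation). -/
def IsTransitive (X : Set (ℕ → ℕ)) : Prop :=
  ∀ u v : List ℕ, InLang X u → InLang X v → ∃ w : List ℕ, InLang X (u ++ w ++ v)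

/-- Topological mixing (language formulation). -/
def IsMixing (X : Set (ℕ → ℕ)) : Prop :=
  ∀ u v : List ℕ, InLang X u → InLang X v →
    ∃ N : ℕ, ∀ n ≥ N, ∃ w : List ℕ, w.length = n ∧ InLang X (u ++ w ++ v)

/-- Intrinsically synchronising word. -/
def IntrinsicallySynchronising (X : Set (ℕ → ℕ)) (w : List ℕ) : Prop :=
  ∀ u v : List ℕ, InLang X (u ++ w) → InLang X (w ++ v) → InLang X (u ++ w ++ v)

/-- Synchronised subshift: transitive with an intrinsically synchronising word. -/
def IsSynchronised (X : Set (ℕ → ℕ)) : Prop :=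
  IsTransitive X ∧ ∃ w : List ℕ, InLang X w ∧ IntrinsicallySynchronising X w

/-- Subshift of finite type over `{0,…,M}`: determined by a finite set of forbidden words. -/
def IsSFT (M : ℕ) (X : Set (ℕ → ℕ)) : Prop :=
  ∃ F : Finset (List ℕ), X = {x | memSigma M x ∧ ∀ w ∈ F, ¬ IsFactorOf w x}

/-- Coded system: the closure of an increasing union of transitive subshifts of finite type. -/
def IsCoded (M : ℕ) (X : Set (ℕ → ℕ)) : Prop :=
  ∃ Y : ℕ → Set (ℕ → ℕ), (∀ n, IsSFT M (Y n) ∧ IsTransitive (Y n)) ∧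
    (∀ n, Y n ⊆ Y (n + 1)) ∧ X = closure (⋃ n, Y n)

/-- `ω⁻`: decrease the last letter of a word by one. -/
def wMinus (w : List ℕ) : List ℕ := w.dropLast ++ [w.getLast! - 1]

/-- `ω⁺`: increase the last letter of a word by one. -/
def wPlus (w : List ℕ) : List ℕ := w.dropLast ++ [w.getLast! + 1]

/-- Reflection of a word. -/
def wRefl (M : ℕ) (w : List ℕ) : List ℕ := w.map (fun c => M - c)

/-- `ω^∞`: the periodic sequence repeating the word `w`. -/
def perSeq (w : List ℕ) : ℕ → ℕ := fun i => w.getD (i % w.length) 0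

/-- The sequence beginning with the word `u` followed by the periodic sequence `v^∞`. -/
def wordThenPer (u v : List ℕ) : ℕ → ℕ :=
  fun i => if i < u.length then u.getD i 0 else perSeq v (i - u.length)

/-- The prefix of length `n` of a sequence, as a word. -/
def prefixWord (a : ℕ → ℕ) (n : ℕ) : List ℕ := (List.range n).map a

/-- A sequence `a ∈ V` is irreducible if `a_1…a_j (\overline{a_1…a_j}⁺)^∞ ≺ a`
whenever `(a_1…a_j⁻)^∞ ∈ V`. -/
def IrreducibleSeq (M : ℕ) (a : ℕ → ℕ) : Prop :=
  ∀ j : ℕ, 1 ≤ j → memV M (perSeq (wMinus (prefixWord a j))) →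
    lexLT (wordThenPer (prefixWord a j) (wPlus (wRefl M (prefixWord a j)))) a

/-- The set `I` of irreducible bases. -/
def memI (M : ℕ) (q : ℝ) : Prop := memVL M q ∧ IrreducibleSeq M (qg M q)

/-- The set `U` of univoque bases. -/
def memU (M : ℕ) (q : ℝ) : Prop :=
  (1 < q ∧ q < M + 1 ∧ ∀ n : ℕ, 1 ≤ n →
      lexLT (reflSeq M (qg M q)) (shift^[n] (qg M q)) ∧
        lexLT (shift^[n] (qg M q)) (qg M q)) ∨ q = M + 1

/-- The set `U̅`: closure of the set of univoque bases. -/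
def memUbar (M : ℕ) (q : ℝ) : Prop :=
  1 < q ∧ q ≤ M + 1 ∧
    ∀ n : ℕ, lexLT (reflSeq M (qg M q)) (shift^[n] (qg M q)) ∧
      lexLE (shift^[n] (qg M q)) (qg M q)

/-- The indices `n_m` of the natural approximation from below (`approxIdx M q 0 = n_1`). -/
noncomputable def approxIdx (M : ℕ) (q : ℝ) : ℕ → ℕ
  | 0 => sInf {n : ℕ | 1 ≤ n ∧ memV M (perSeq (wMinus (prefixWord (qg M q) n)))}
  | m + 1 => sInf {n : ℕ | approxIdx M q m < n ∧ memV M (perSeq (wMinus (prefixWord (qg M q) n)))}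

/-- The base in `(1, M+1]` whose quasi-greedy expansion is `a` (via choice). -/
noncomputable def baseOf (M : ℕ) (a : ℕ → ℕ) : ℝ :=
  if h : ∃ q : ℝ, 1 < q ∧ q ≤ M + 1 ∧ qg M q = a then h.choose else 0

/-- The natural approximation from below of `q` (`approxBase M q 0 = q_1⁻`),
determined by `α(q_m⁻) = (α_1(q)…α_{n_m}(q)⁻)^∞`. -/
noncomputable def approxBase (M : ℕ) (q : ℝ) (m : ℕ) : ℝ :=
  baseOf M (perSeq (wMinus (prefixWord (qg M q) (approxIdx M q m))))

/-- Strongly irreducible base: `q ∈ I` and all but finitely many terms of the natural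
approximation from below lie in `I`. -/
def memSI (M : ℕ) (q : ℝ) : Prop :=
  memI M q ∧ ∃ N : ℕ, ∀ m ≥ N, memI M (approxBase M q m)

/-- Weakly irreducible base: `q ∈ I` but infinitely many terms of the natural
approximation from below are not in `I`. -/
def memWI (M : ℕ) (q : ℝ) : Prop :=
  memI M q ∧ ∀ N : ℕ, ∃ m ≥ N, ¬ memI M (approxBase M q m)

/-- The generalised golden ratio `q_G(M)`. -/
noncomputable def qG (M : ℕ) : ℝ :=
  if M % 2 = 0 then ((M / 2 : ℕ) : ℝ) + 1
  else (((M / 2 : ℕ) : ℝ) + 1 +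
    Real.sqrt (((M / 2 : ℕ) : ℝ) ^ 2 + 6 * ((M / 2 : ℕ) : ℝ) + 5)) / 2

/-- The metric on `Σ_M`: `d(x,y) = 2^{-j}` where `j` is the first (1-indexed) place
where `x` and `y` differ. -/
noncomputable def seqDist (x y : ℕ → ℕ) : ℝ :=
  if x = y then 0 else (1 / 2 : ℝ) ^ (sInf {i : ℕ | x i ≠ y i} + 1)

/-- Fundamental word (Allaart). -/
def IsFundamentalWord (M : ℕ) (w : List ℕ) : Prop :=
  2 < w.length ∧ ∀ i : ℕ, 1 ≤ i → i ≤ w.length - 1 →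
    wordLE (wRefl M (w.take (w.length - i))) (w.drop i) ∧
      wordLT (w.drop i) (w.take (w.length - i))

/-- The set `I_N`. -/
def memIN (M N : ℕ) (q : ℝ) : Prop :=
  memVL M q ∧
    prefixWord (qg M q) (2 * N) = List.replicate (2 * N - 1) M ++ [0] ∧
    ∀ r : ℕ, 2 ≤ r →
      wordLT (List.replicate N 0) ((List.range N).map (fun i => qg M q (r * N + i))) ∧
      wordLT ((List.range N).map (fun i => qg M q (r * N + i))) (List.replicate N M)

/-- The (forward) orbit of a sequence under the shift. -/
def orbit (a : ℕ → ℕ) : Set (ℕ → ℕ) := {y | ∃ n : ℕ, y = shift^[n] a}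


theorem shift_iterate_apply (x : ℕ → ℕ) (n i : ℕ) : shift^[n] x i = x (n + i) := by
  induction n generalizing i with
  | zero => simp
  | succ n ih =>
    rw [Function.iterate_succ_apply', shift, ih]
    congr 1
    omega

/-- A sequence exceeding `y` at the first place where they differ is not below `y`. -/
theorem not_lexLE_of_agree {x y : ℕ → ℕ} {n : ℕ} (h : ∀ i < n, x i = y i) (hn : y n < x n) :
    ¬ lexLE x y := by
  rintro (rfl | ⟨m, hm, hlt⟩)
  · exact lt_irrefl _ hn
  · rcases lt_trichotomy m n with hmn | rfl | hmn
    · exact hlt.ne (h m hmn)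
    · exact lt_asymm hn hlt
    · exact hn.ne' (hm n hmn)

theorem lexLE_antisymm {x y : ℕ → ℕ} (h : lexLE x y) (h' : lexLE y x) : x = y := by
  rcases h with h | ⟨n, hn, hlt⟩
  · exact h
  · exact absurd h' (not_lexLE_of_agree (fun i hi => (hn i hi).symm) hlt)

theorem prefixWord_succ (a : ℕ → ℕ) (n : ℕ) :
    prefixWord a (n + 1) = prefixWord a n ++ [a n] := by
  simp [prefixWord, List.range_succ]

@[simp] theorem length_prefixWord (a : ℕ → ℕ) (n : ℕ) : (prefixWord a n).length = n := by
  simp [prefixWord]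

theorem getD_prefixWord (a : ℕ → ℕ) {n i : ℕ} (h : i < n) : (prefixWord a n).getD i 0 = a i := by
  simp [prefixWord, List.getD_eq_getElem?_getD, h]

theorem wMinus_concat (w : List ℕ) (c : ℕ) : wMinus (w ++ [c]) = w ++ [c - 1] := by
  simp [wMinus, List.getLast!_eq_getLast?_getD]

theorem wPlus_concat (w : List ℕ) (c : ℕ) : wPlus (w ++ [c]) = w ++ [c + 1] := by
  simp [wPlus, List.getLast!_eq_getLast?_getD]

theorem perSeq_concat_of_lt (w : List ℕ) (c : ℕ) {i : ℕ} (h : i < w.length) :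
    perSeq (w ++ [c]) i = w.getD i 0 := by
  have h1 : i % (w.length + 1) = i := Nat.mod_eq_of_lt (by omega)
  simp [perSeq, h1, List.getD_eq_getElem?_getD, List.getElem?_append_left h]

theorem perSeq_concat_length (w : List ℕ) (c : ℕ) : perSeq (w ++ [c]) w.length = c := by
  simp [perSeq]

theorem perSeq_mod (w : List ℕ) (i : ℕ) : perSeq w (i % w.length) = perSeq w i := by
  simp [perSeq]

/-- The periodic sequence `(a_1…a_{n+1}⁻)^∞`. -/
def lowerPer (a : ℕ → ℕ) (n : ℕ) : ℕ → ℕ := perSeq (wMinus (prefixWord a (n + 1)))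

theorem lowerPer_of_lt (a : ℕ → ℕ) {n i : ℕ} (h : i < n) : lowerPer a n i = a i := by
  rw [lowerPer, prefixWord_succ, wMinus_concat, perSeq_concat_of_lt _ _ (by simpa using h),
    getD_prefixWord a h]

theorem lowerPer_self (a : ℕ → ℕ) (n : ℕ) : lowerPer a n n = a n - 1 := by
  have := perSeq_concat_length (prefixWord a n) (a n - 1)
  rwa [length_prefixWord, ← wMinus_concat, ← prefixWord_succ] at this

theorem lowerPer_mod (a : ℕ → ℕ) (n i : ℕ) : lowerPer a n (i % (n + 1)) = lowerPer a n i := by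
  have := perSeq_mod (wMinus (prefixWord a (n + 1))) i
  rwa [show (wMinus (prefixWord a (n + 1))).length = n + 1 by
    simp [prefixWord_succ, wMinus_concat]] at this

theorem lowerPer_congr (a : ℕ → ℕ) {n i j : ℕ} (h : i ≡ j [MOD n + 1]) :
    lowerPer a n i = lowerPer a n j := by
  rw [← lowerPer_mod a n i, ← lowerPer_mod a n j, h]

/-- A sequence of `V` starting with `MM` is irreducible as soon as no shift by `j ≥ 2` agrees with
the reflection for `j - 1` letters. -/
theorem irreducibleSeq_of_mismatch {M : ℕ} (hM : 1 ≤ M) {a : ℕ → ℕ} (ha : memV M a)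
    (h0 : a 0 = M) (h1 : a 1 = M)
    (h : ∀ j, 2 ≤ j → ∃ i, i + 1 < j ∧ a (j + i) ≠ M - a i) : IrreducibleSeq M a := by
  intro j hj hV
  obtain ⟨k, rfl⟩ : ∃ k, j = k + 1 := ⟨j - 1, by omega⟩
  rw [prefixWord_succ, wMinus_concat] at hV
  have hper : ∀ i < k, perSeq (wPlus (wRefl M (prefixWord a (k + 1)))) i = M - a i := by
    intro i hi
    rw [prefixWord_succ, wRefl, List.map_append, List.map_singleton, wPlus_concat,
      perSeq_concat_of_lt _ _ (by simpa using hi)]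
    simp [prefixWord, List.getD_eq_getElem?_getD, hi]
  have hpre : ∀ i < k + 1,
      wordThenPer (prefixWord a (k + 1)) (wPlus (wRefl M (prefixWord a (k + 1)))) i = a i := by
    intro i hi
    simp only [wordThenPer, length_prefixWord, hi, if_true, getD_prefixWord a hi]
  have hpost : ∀ i,
      wordThenPer (prefixWord a (k + 1)) (wPlus (wRefl M (prefixWord a (k + 1)))) (k + 1 + i) =
        perSeq (wPlus (wRefl M (prefixWord a (k + 1)))) i := by
    intro i
    have hlt : ¬ k + 1 + i < k + 1 := by omega
    simp only [wordThenPer, length_prefixWord, hlt, if_false, Nat.add_sub_cancel_left]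
  rcases Nat.eq_zero_or_pos k with rfl | hk
  · have hM2 : 2 ≤ M := by
      by_contra hlt
      have hM1 : M = 1 := by omega
      subst hM1
      have := (hV.2 0).1
      refine not_lexLE_of_agree (n := 0) (by simp) ?_ this
      simp [reflSeq, perSeq, prefixWord, h0]
    refine ⟨1, fun i hi => hpre i hi, ?_⟩
    have h2 := hpost 0
    rw [add_zero] at h2
    simp only [zero_add] at h2 ⊢
    rw [h2, h1, show prefixWord a 1 = [] ++ [a 0] from rfl, wRefl, List.map_append,
      List.map_singleton, wPlus_concat]
    simp [perSeq, h0]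
    omega
  · obtain ⟨i, hi, hne⟩ := h (k + 1) (by omega)
    rcases (ha.2 (k + 1)).1 with heq | ⟨m, hm, hlt⟩
    · have := congrFun heq i
      rw [shift_iterate_apply, reflSeq] at this
      exact absurd this.symm hne
    · rw [shift_iterate_apply, reflSeq] at hlt
      have hmi : m ≤ i := by
        by_contra hcon
        have := hm i (by omega)
        rw [shift_iterate_apply, reflSeq] at this
        exact hne this.symm
      refine ⟨k + 1 + m, fun t ht => ?_, ?_⟩
      · rcases lt_or_ge t (k + 1) with htk | htk
        · exact hpre t htk
        · obtain ⟨s, rfl⟩ := Nat.exists_eq_add_of_le htk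
          have := hm s (by omega)
          rw [shift_iterate_apply, reflSeq] at this
          rw [hpost, hper s (by omega), this]
      · rw [hpost, hper m (by omega)]
        exact hlt

/-- If shifts of `a` agree with the reflection of `a` only over short stretches, then
`(a_1…a_{n+1}⁻)^∞` is irreducible whenever it lies in `V` and `n` is not too small. -/
theorem irreducibleSeq_lowerPer {M : ℕ} (hM : 1 ≤ M) {a : ℕ → ℕ} (h0 : a 0 = M) (h1 : a 1 = M)
    (h : ∀ r, 1 ≤ r → ∃ i, 4 * i ≤ r ∧ a (r + i) ≠ M - a i) {n : ℕ} (hn : 20 ≤ n)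
    (hV : memV M (lowerPer a n)) : IrreducibleSeq M (lowerPer a n) := by
  refine irreducibleSeq_of_mismatch hM hV (by rw [lowerPer_of_lt a (by omega), h0])
    (by rw [lowerPer_of_lt a (by omega), h1]) fun j hj => ?_
  have hmod : j % (n + 1) < n + 1 := Nat.mod_lt _ (by omega)
  have hle : j % (n + 1) ≤ j := Nat.mod_le _ _
  have hcong : ∀ i, lowerPer a n (j + i) = lowerPer a n (j % (n + 1) + i) := fun i =>
    lowerPer_congr a (by simp [Nat.ModEq])
  set r := j % (n + 1) with hr
  rcases Nat.eq_zero_or_pos r with hr0 | hr0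
  · refine ⟨0, by omega, ?_⟩
    rw [hcong, hr0, add_zero, lowerPer_of_lt a (by omega), h0]
    omega
  · obtain ⟨i, hi, hne⟩ := h r hr0
    by_cases hin : r + i < n
    · refine ⟨i, by omega, ?_⟩
      rwa [hcong, lowerPer_of_lt a hin, lowerPer_of_lt a (by omega)]
    · obtain ⟨i', hi', hne'⟩ := h (n + 1 - r) (by omega)
      refine ⟨n + 1 - r + i', by omega, ?_⟩
      rw [hcong, show r + (n + 1 - r + i') = i' + (n + 1) by omega,
        lowerPer_congr a (show i' + (n + 1) ≡ i' [MOD n + 1] by simp [Nat.ModEq]),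
        lowerPer_of_lt a (show n + 1 - r + i' < n by omega), lowerPer_of_lt a (by omega)]
      have hs := hV.1 (n + 1 - r + i')
      rw [lowerPer_of_lt a (by omega)] at hs
      omega

/-- If infinitely many prefixes of `α(q)` qualify, then every index `n_m` is one of them. -/
theorem memV_approxIdx {M : ℕ} {q : ℝ}
    (h : ∀ N, ∃ n > N, memV M (perSeq (wMinus (prefixWord (qg M q) n)))) (m : ℕ) :
    m < approxIdx M q m ∧ memV M (perSeq (wMinus (prefixWord (qg M q) (approxIdx M q m)))) := by
  induction m with
  | zero =>
    obtain ⟨n, hn, hV⟩ := h 0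
    exact Nat.sInf_mem
      (s := {n : ℕ | 1 ≤ n ∧ memV M (perSeq (wMinus (prefixWord (qg M q) n)))}) ⟨n, hn, hV⟩
  | succ m ih =>
    obtain ⟨n, hn, hV⟩ := h (approxIdx M q m)
    have := Nat.sInf_mem
      (s := {n : ℕ | approxIdx M q m < n ∧
        memV M (perSeq (wMinus (prefixWord (qg M q) n)))}) ⟨n, hn, hV⟩
    exact ⟨lt_of_le_of_lt (Nat.succ_le_of_lt ih.1) this.1, this.2⟩

theorem summable_digits {M : ℕ} {a : ℕ → ℕ} (ha : memSigma M a) {q : ℝ} (hq : 1 < q) :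
    Summable fun i => (a i : ℝ) / q ^ (i + 1) := by
  have hg : Summable fun i : ℕ => (M : ℝ) * (q⁻¹ * q⁻¹ ^ i) :=
    ((summable_geometric_of_lt_one (by positivity) (inv_lt_one_of_one_lt₀ hq)).mul_left _).mul_left _
  refine Summable.of_nonneg_of_le (fun i => by positivity) (fun i => ?_) hg
  rw [← pow_succ', inv_pow, ← div_eq_mul_inv]
  have : (a i : ℝ) ≤ M := by exact_mod_cast ha i
  gcongr

/-- The value of the digit sequence `a` in base `q`. -/
noncomputable def digitSum (q : ℝ) (a : ℕ → ℕ) : ℝ := ∑' i : ℕ, (a i : ℝ) / q ^ (i + 1)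

theorem digitSum_split {M : ℕ} {a : ℕ → ℕ} (ha : memSigma M a) {q : ℝ} (hq : 1 < q) (n : ℕ) :
    digitSum q a = ∑ i ∈ Finset.range n, (a i : ℝ) / q ^ (i + 1) +
      digitSum q (shift^[n] a) / q ^ n := by
  rw [digitSum, ← (summable_digits ha hq).sum_add_tsum_nat_add n, digitSum, ← tsum_div_const]
  congr 2
  ext i
  rw [shift_iterate_apply, div_div, ← pow_add, add_comm n i, add_right_comm]

theorem digitSum_nonneg {q : ℝ} (hq : 1 < q) (a : ℕ → ℕ) : 0 ≤ digitSum q a :=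
  tsum_nonneg fun i => by positivity

theorem memSigma_shift {M : ℕ} {a : ℕ → ℕ} (ha : memSigma M a) (n : ℕ) :
    memSigma M (shift^[n] a) := fun i => by
  rw [shift_iterate_apply]
  exact ha _

theorem digitSum_pos {M : ℕ} {a : ℕ → ℕ} (ha : memSigma M a) {q : ℝ} (hq : 1 < q) {m : ℕ}
    (hm : a m ≠ 0) : 0 < digitSum q a := by
  have hm' : (0 : ℝ) < a m := by exact_mod_cast Nat.pos_of_ne_zero hm
  exact (summable_digits ha hq).tsum_pos (fun i => by positivity) m (by positivity)

/-- The digit sum is at most `M / (q - 1)`. -/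
theorem digitSum_le {M : ℕ} {a : ℕ → ℕ} (ha : memSigma M a) {q : ℝ} (hq : 1 < q) :
    digitSum q a ≤ M / (q - 1) := by
  have h : HasSum (fun i : ℕ => (M : ℝ) * (q⁻¹ * q⁻¹ ^ i)) (M * (q⁻¹ * (1 - q⁻¹)⁻¹)) :=
    ((hasSum_geometric_of_lt_one (by positivity) (inv_lt_one_of_one_lt₀ hq)).mul_left _).mul_left _
  have hval : (M : ℝ) * (q⁻¹ * (1 - q⁻¹)⁻¹) = M / (q - 1) := by
    have : q - 1 ≠ 0 := by linarith
    have h2 : 1 - q⁻¹ ≠ 0 := by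
      have := inv_lt_one_of_one_lt₀ hq
      linarith
    field_simp
  rw [← hval]
  refine hasSum_le (fun i => ?_) (summable_digits ha hq).hasSum h
  rw [← pow_succ', inv_pow, ← div_eq_mul_inv]
  have : (a i : ℝ) ≤ M := by exact_mod_cast ha i
  gcongr

/-- Tails of a shift-maximal expansion of `1` have value at most `1`. -/
theorem digitSum_shift_le_one {M : ℕ} {a : ℕ → ℕ} (ha : memSigma M a)
    (hmax : ∀ n, lexLE (shift^[n] a) a) {q : ℝ} (hq : 1 < q) (h1 : digitSum q a = 1) (n : ℕ) :
    digitSum q (shift^[n] a) ≤ 1 := by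
  have hstep : ∀ n, digitSum q (shift^[n] a) ≤ 1 ∨
      ∃ m k, digitSum q (shift^[n] a) - 1 ≤
        (digitSum q (shift^[m] a) - 1) / q ^ (k + 1) := by
    intro n
    rcases hmax n with heq | ⟨k, hk, hlt⟩
    · rw [heq, h1]
      exact Or.inl le_rfl
    · refine Or.inr ⟨k + 1 + n, k, ?_⟩
      have hA := digitSum_split (memSigma_shift ha n) hq (k + 1)
      have hB := digitSum_split ha hq (k + 1)
      have hC := digitSum_nonneg hq (shift^[k + 1] a)
      rw [← Function.iterate_add_apply, Finset.sum_range_succ,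
        Finset.sum_congr rfl fun i hi => by rw [hk i (Finset.mem_range.1 hi)]] at hA
      rw [h1, Finset.sum_range_succ] at hB
      have hd : (shift^[n] a k : ℝ) / q ^ (k + 1) ≤ ((a k : ℝ) - 1) / q ^ (k + 1) := by
        have : (shift^[n] a k : ℝ) + 1 ≤ a k := by exact_mod_cast hlt
        gcongr
        linarith
      have : 0 ≤ digitSum q (shift^[k + 1] a) / q ^ (k + 1) := by positivity
      rw [sub_div] at hd ⊢
      linarith
  have hbound : ∀ j n, digitSum q (shift^[n] a) - 1 ≤ M / (q - 1) * q⁻¹ ^ j := by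
    have hC : 0 ≤ (M : ℝ) / (q - 1) := (digitSum_nonneg hq a).trans (digitSum_le ha hq)
    intro j
    induction j with
    | zero =>
      intro n
      have := digitSum_le (memSigma_shift ha n) hq
      rw [pow_zero, mul_one]
      linarith
    | succ j ih =>
      intro n
      rcases hstep n with h | ⟨m, k, h⟩
      · have : 0 ≤ (M : ℝ) / (q - 1) * q⁻¹ ^ (j + 1) := by positivity
        linarith
      · calc _ ≤ _ := h
          _ ≤ (M / (q - 1) * q⁻¹ ^ j) / q ^ (k + 1) := by
            gcongr
            exact ih m
          _ ≤ (M / (q - 1) * q⁻¹ ^ j) / q ^ 1 := by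
            gcongr
            · exact hq.le
            · omega
          _ = _ := by rw [pow_one, pow_succ, ← mul_assoc, div_eq_mul_inv]
  have hlim : Filter.Tendsto (fun j : ℕ => (M : ℝ) / (q - 1) * q⁻¹ ^ j) Filter.atTop (nhds 0) := by
    simpa using (tendsto_pow_atTop_nhds_zero_of_lt_one (by positivity : 0 ≤ q⁻¹)
      (inv_lt_one_of_one_lt₀ hq)).const_mul ((M : ℝ) / (q - 1))
  have := ge_of_tendsto' hlim fun j => hbound j n
  linarith

/-- A shift-maximal sequence whose value in base `q` is `1` is the quasi-greedy expansion. -/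
theorem qg_eq_of_digitSum_eq_one {M : ℕ} {a : ℕ → ℕ} (ha : memSigma M a)
    (hmax : ∀ n, lexLE (shift^[n] a) a) (hinf : ∀ n, ∃ m ≥ n, a m ≠ 0) {q : ℝ} (hq : 1 < q)
    (h1 : digitSum q a = 1) : qg M q = a := by
  have hqg : IsQuasiGreedy M q a := by
    refine ⟨ha, hinf, h1, fun b hb hbinf hb1 => ?_⟩
    by_contra hcon
    have hne : ∃ n, b n ≠ a n := by
      by_contra hall
      push Not at hall
      exact hcon (Or.inl (funext hall))
    have hlt := Nat.find_spec hne
    have hagree : ∀ i < Nat.find hne, b i = a i := fun i hi => not_not.1 (Nat.find_min hne hi)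
    generalize Nat.find hne = n at hlt hagree
    have hlt' : a n + 1 ≤ b n := by
      by_contra hba
      exact hcon (Or.inr ⟨n, hagree, by omega⟩)
    have hA := digitSum_split ha hq (n + 1)
    have hB := digitSum_split hb hq (n + 1)
    change digitSum q b = 1 at hb1
    rw [h1, Finset.sum_range_succ] at hA
    rw [hb1, Finset.sum_range_succ,
      Finset.sum_congr rfl fun i hi => by rw [hagree i (Finset.mem_range.1 hi)]] at hB
    have hT := digitSum_shift_le_one ha hmax hq h1 (n + 1)
    obtain ⟨m, hm, hbm⟩ := hbinf (n + 1)
    have hP : 0 < digitSum q (shift^[n + 1] b) := by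
      refine digitSum_pos (memSigma_shift hb _) hq (m := m - (n + 1)) ?_
      rwa [shift_iterate_apply, Nat.add_sub_cancel' hm]
    have hd : ((a n : ℝ) + 1) / q ^ (n + 1) ≤ (b n : ℝ) / q ^ (n + 1) := by
      have : (a n : ℝ) + 1 ≤ b n := by exact_mod_cast hlt'
      gcongr
    have hqk : (0 : ℝ) < q ^ (n + 1) := by positivity
    have hT' : digitSum q (shift^[n + 1] a) / q ^ (n + 1) ≤ 1 / q ^ (n + 1) := by gcongr
    have hP' : 0 < digitSum q (shift^[n + 1] b) / q ^ (n + 1) := by positivity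
    rw [add_div] at hd
    linarith
  have hex : ∃ a, IsQuasiGreedy M q a := ⟨a, hqg⟩
  rw [qg, dif_pos hex]
  have hc := hex.choose_spec
  exact lexLE_antisymm (hqg.2.2.2 _ hc.1 hc.2.1 hc.2.2.1) (hc.2.2.2 _ hqg.1 hqg.2.1 hqg.2.2.1)

/-- Every sequence of `V` starting with `M` and having infinitely many nonzero entries is a
quasi-greedy expansion. -/
theorem exists_qg_eq {M : ℕ} (hM : 1 ≤ M) {a : ℕ → ℕ} (ha : memV M a) (h0 : a 0 = M)
    (hinf : ∀ n, ∃ m ≥ n, a m ≠ 0) : ∃ q : ℝ, 1 < q ∧ q ≤ M + 1 ∧ qg M q = a := by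
  obtain ⟨m, hm, ham⟩ := hinf 1
  have hMr : (1 : ℝ) ≤ M := by exact_mod_cast hM
  set x₀ : ℝ := 1 - 1 / (m + 2) with hx₀
  have hx₀lt : x₀ < 1 := by
    have : (0 : ℝ) < 1 / (m + 2) := by positivity
    linarith
  have hx₀ge : 1 / 2 ≤ x₀ := by
    have : (1 : ℝ) / (m + 2) ≤ 1 / 2 := by
      gcongr
      have : (0 : ℝ) ≤ m := by positivity
      linarith
    linarith
  have hMhalf : ((M : ℝ) + 1)⁻¹ ≤ 1 / 2 := by
    rw [one_div]
    gcongr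
    linarith
  have hle : ((M : ℝ) + 1)⁻¹ ≤ x₀ := hMhalf.trans hx₀ge
  have hpos : (0 : ℝ) < ((M : ℝ) + 1)⁻¹ := by positivity
  have hcont : ContinuousOn (fun x : ℝ => ∑' i : ℕ, (a i : ℝ) * x ^ (i + 1))
      (Set.Icc ((M : ℝ) + 1)⁻¹ x₀) := by
    refine continuousOn_tsum (u := fun i => (M : ℝ) * (x₀ * x₀ ^ i)) (fun i => by fun_prop)
      (((summable_geometric_of_lt_one (by linarith) hx₀lt).mul_left _).mul_left _) ?_
    intro i x hx
    have hx0 : 0 ≤ x := hpos.le.trans hx.1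
    have hai : (a i : ℝ) ≤ M := by exact_mod_cast ha.1 i
    rw [Real.norm_of_nonneg (by positivity), ← pow_succ']
    have := hx.2
    gcongr
  have heq : ∀ x : ℝ, ∑' i : ℕ, (a i : ℝ) * x ^ (i + 1) = digitSum x⁻¹ a := fun x => by
    simp [digitSum, div_eq_mul_inv]
  have hlow : ∑' i : ℕ, (a i : ℝ) * ((M : ℝ) + 1)⁻¹ ^ (i + 1) ≤ 1 := by
    rw [heq, inv_inv]
    refine (digitSum_le ha.1 (by linarith)).trans_eq ?_
    rw [add_sub_cancel_right, div_self (by positivity)]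
  have hhigh : 1 ≤ ∑' i : ℕ, (a i : ℝ) * x₀ ^ (i + 1) := by
    have hq : 1 < x₀⁻¹ := (one_lt_inv₀ (by linarith)).2 hx₀lt
    have hs := summable_digits ha.1 hq
    have hsum := hs.sum_le_tsum {0, m} fun i _ => by positivity
    rw [heq]
    refine le_trans ?_ hsum
    have h0m : (0 : ℕ) ≠ m := by omega
    rw [Finset.sum_pair h0m]
    have h1 : (1 : ℝ) ≤ a 0 := by exact_mod_cast h0 ▸ hM
    have h2 : (1 : ℝ) ≤ a m := by exact_mod_cast Nat.one_le_iff_ne_zero.2 ham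
    have hx0 : 0 ≤ x₀ := by linarith
    have hb : 1 / ((m : ℝ) + 2) ≤ x₀ ^ (m + 1) := by
      have hbern := one_add_mul_le_pow (a := -(1 / ((m : ℝ) + 2))) (by linarith) (m + 1)
      rw [← sub_eq_add_neg, ← hx₀] at hbern
      refine le_trans (le_of_eq ?_) hbern
      push_cast
      field_simp
      ring
    simp only [inv_pow, div_inv_eq_mul, zero_add, pow_one]
    nlinarith [mul_le_mul_of_nonneg_right h1 hx0,
      mul_le_mul_of_nonneg_right h2 (pow_nonneg hx0 (m + 1))]
  obtain ⟨x, hx, hx1⟩ := intermediate_value_Icc hle hcont ⟨hlow, hhigh⟩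
  have hxpos : 0 < x := hpos.trans_le hx.1
  have hq : 1 < x⁻¹ := (one_lt_inv₀ hxpos).2 (hx.2.trans_lt hx₀lt)
  refine ⟨x⁻¹, hq, inv_le_of_inv_le₀ (by positivity) hx.1, ?_⟩
  exact qg_eq_of_digitSum_eq_one ha.1 (fun n => (ha.2 n).2) hinf hq ((heq x).symm.trans hx1)

theorem baseOf_spec {M : ℕ} {a : ℕ → ℕ} (h : ∃ q : ℝ, 1 < q ∧ q ≤ M + 1 ∧ qg M q = a) :
    1 < baseOf M a ∧ baseOf M a ≤ M + 1 ∧ qg M (baseOf M a) = a := by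
  rw [baseOf, dif_pos h]
  exact h.choose_spec

/-- A sequence over `{0, M}` beginning with `MMMM0M0M…` whose letters at the positions `16 ^ k + t`
with `8 * t ≤ 16 ^ k` and `k ≥ 2` are the reflections of its first letters, and which elsewhere
alternates between `0` and `M`. -/
def copySeq (M i : ℕ) : ℕ :=
  if i < 4 then M
  else if 256 ≤ i ∧ 8 * (i - 16 ^ Nat.log 16 i) ≤ 16 ^ Nat.log 16 i then
    M - copySeq M (i - 16 ^ Nat.log 16 i)
  else if i % 2 = 1 then M else 0
termination_by i
decreasing_by
  have : 0 < 16 ^ Nat.log 16 i := by positivity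
  omega

/-- The positions at which `copySeq` alternates. -/
def IsFiller (i : ℕ) : Prop :=
  4 ≤ i ∧ (i < 256 ∨ ∃ k s, i = 16 ^ (k + 2) + s ∧ 16 ^ (k + 2) < 8 * s ∧ s < 15 * 16 ^ (k + 2))

theorem position_cases (i : ℕ) :
    i < 4 ∨ IsFiller i ∨ ∃ k s, i = 16 ^ (k + 2) + s ∧ 8 * s ≤ 16 ^ (k + 2) := by
  rcases lt_or_ge i 4 with h4 | h4
  · exact Or.inl h4
  rcases lt_or_ge i 256 with h | h
  · exact Or.inr (Or.inl ⟨h4, Or.inl h⟩)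
  have h2 : 2 ≤ Nat.log 16 i := Nat.le_log_of_pow_le (by norm_num) (by omega)
  obtain ⟨k, hk⟩ := Nat.exists_eq_add_of_le' h2
  have hle : 16 ^ (k + 2) ≤ i := hk ▸ Nat.pow_log_le_self 16 (by omega)
  have hlt : i < 16 ^ (k + 3) := by
    have := Nat.lt_pow_succ_log_self (b := 16) (by norm_num) i
    rwa [hk] at this
  obtain ⟨s, rfl⟩ := Nat.exists_eq_add_of_le hle
  have hp : 16 ^ (k + 3) = 16 * 16 ^ (k + 2) := by ring
  by_cases hs : 8 * s ≤ 16 ^ (k + 2)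
  · exact Or.inr (Or.inr ⟨k, s, rfl, hs⟩)
  · exact Or.inr (Or.inl ⟨h4, Or.inr ⟨k, s, rfl, by omega, by omega⟩⟩)

theorem sixteen_pow_add_two (k : ℕ) : 16 ^ (k + 2) = 256 * 16 ^ k ∧ 0 < 16 ^ k :=
  ⟨by ring, by positivity⟩

theorem log_sixteen_pow_add {k s : ℕ} (hs : s < 15 * 16 ^ k) : Nat.log 16 (16 ^ k + s) = k :=
  Nat.log_eq_of_pow_le_of_lt_pow (by omega) (by rw [pow_succ]; omega)

theorem copySeq_of_lt {M i : ℕ} (h : i < 4) : copySeq M i = M := by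
  rw [copySeq, if_pos h]

theorem copySeq_copy {M k s : ℕ} (h : 8 * s ≤ 16 ^ (k + 2)) :
    copySeq M (16 ^ (k + 2) + s) = M - copySeq M s := by
  obtain ⟨hp, hp'⟩ := sixteen_pow_add_two k
  rw [copySeq, if_neg (by omega), log_sixteen_pow_add (by omega), Nat.add_sub_cancel_left,
    if_pos ⟨by omega, h⟩]

theorem copySeq_filler {M i : ℕ} (h : IsFiller i) :
    copySeq M i = if i % 2 = 1 then M else 0 := by
  obtain ⟨h4, h⟩ := h
  rw [copySeq, if_neg (by omega), if_neg]
  rintro ⟨h256, hle⟩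
  rcases h with h | ⟨k, s, rfl, hs, hs'⟩
  · omega
  · rw [log_sixteen_pow_add hs', Nat.add_sub_cancel_left] at hle
    omega

theorem copySeq_filler_odd {M i : ℕ} (h : IsFiller i) (hi : i % 2 = 1) : copySeq M i = M := by
  rw [copySeq_filler h, if_pos hi]

theorem copySeq_filler_even {M i : ℕ} (h : IsFiller i) (hi : i % 2 = 0) : copySeq M i = 0 := by
  rw [copySeq_filler h, if_neg (by omega)]

theorem copySeq_le (M i : ℕ) : copySeq M i ≤ M := by
  rw [copySeq]
  split_ifs <;> omega

theorem copySeq_succ_of_filler_even {M i : ℕ} (h : IsFiller i) (hi : i % 2 = 0) :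
    copySeq M (i + 1) = M := by
  refine copySeq_filler_odd ⟨by have := h.1; omega, ?_⟩ (by omega)
  rcases h.2 with h | ⟨k, s, rfl, hs, hs'⟩
  · exact Or.inl (by omega)
  · obtain ⟨hp, -⟩ := sixteen_pow_add_two k
    exact Or.inr ⟨k, s + 1, by omega, by omega, by omega⟩

theorem copySeq_pow (M k : ℕ) : copySeq M (16 ^ (k + 2)) = 0 := by
  have := copySeq_copy (M := M) (k := k) (s := 0) (by simp)
  rwa [add_zero, copySeq_of_lt (i := 0) (by norm_num), Nat.sub_self] at this

theorem copySeq_succ_of_filler_odd {M i : ℕ} (h : IsFiller i) (hi : i % 2 = 1) :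
    copySeq M (i + 1) = 0 := by
  rcases h.2 with h' | ⟨k, s, rfl, hs, hs'⟩
  · rcases eq_or_ne i 255 with rfl | hne
    · exact copySeq_pow M 0
    · exact copySeq_filler_even ⟨by have := h.1; omega, Or.inl (by omega)⟩ (by omega)
  · obtain ⟨hp, -⟩ := sixteen_pow_add_two k
    rcases eq_or_ne (s + 1) (15 * 16 ^ (k + 2)) with heq | hne
    · have := copySeq_pow M (k + 1)
      rwa [show 16 ^ (k + 1 + 2) = 16 ^ (k + 2) + s + 1 by
        rw [show 16 ^ (k + 1 + 2) = 16 * 16 ^ (k + 2) by ring]; omega] at this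
    · exact copySeq_filler_even ⟨by have := h.1; omega, Or.inr ⟨k, s + 1, by omega, by omega,
        by omega⟩⟩ (by omega)

/-- A short stretch starting before `2 * 16 ^ (k + 1)` does not extend beyond it. -/
theorem add_le_of_short {r i k : ℕ} (hr : r < 2 * 16 ^ (k + 1)) (hi : 4 * i ≤ r + 12)
    (hfill : IsFiller r → i ≤ 1) : r + i ≤ 2 * 16 ^ (k + 1) := by
  have hk : 16 ≤ 16 ^ (k + 1) := Nat.le_self_pow (by omega) 16
  rcases position_cases r with h | h | ⟨l, s, rfl, hs⟩
  · omega
  · have := hfill h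
    omega
  · obtain ⟨hp, hp'⟩ := sixteen_pow_add_two l
    have hlt : 16 ^ (l + 2) < 16 ^ (k + 1 + 1) := by
      rw [pow_succ 16 (k + 1)]
      omega
    have hle : 16 ^ (l + 2) ≤ 16 ^ (k + 1) := by
      have := (Nat.pow_lt_pow_iff_right (by norm_num)).1 hlt
      exact Nat.pow_le_pow_right (by norm_num) (by omega)
    omega

theorem isFiller_two_mul_pow (k : ℕ) : IsFiller (2 * 16 ^ (k + 1)) := by
  have h16 : 16 ≤ 16 ^ (k + 1) := Nat.le_self_pow (by omega) 16
  refine ⟨by omega, ?_⟩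
  rcases k with _ | k
  · exact Or.inl (by norm_num)
  · have hp : 0 < 16 ^ (k + 2) := by positivity
    exact Or.inr ⟨k, 16 ^ (k + 2), by ring, by linarith, by linarith⟩

/-- Every proper shift of `copySeq` lies strictly between its reflection and itself, and this is
already visible on short prefixes. -/
theorem copySeq_compare {M : ℕ} (hM : 1 ≤ M) (r : ℕ) (hr : 1 ≤ r) :
    (∃ i, 4 * i ≤ r ∧ (IsFiller r → i ≤ 1) ∧
      (∀ t < i, copySeq M (r + t) = M - copySeq M t) ∧ M - copySeq M i < copySeq M (r + i)) ∧
    ∃ i, 4 * i ≤ r + 12 ∧ (IsFiller r → i ≤ 1) ∧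
      (∀ t < i, copySeq M (r + t) = copySeq M t) ∧ copySeq M (r + i) < copySeq M i := by
  induction r using Nat.strong_induction_on with
  | _ r ih =>
  have h0 : copySeq M 0 = M := copySeq_of_lt (by norm_num)
  have h1 : copySeq M 1 = M := copySeq_of_lt (by norm_num)
  have h2 : copySeq M 2 = M := copySeq_of_lt (by norm_num)
  have h3 : copySeq M 3 = M := copySeq_of_lt (by norm_num)
  have h4 : copySeq M 4 = 0 := copySeq_filler_even ⟨le_rfl, Or.inl (by norm_num)⟩ (by norm_num)
  rcases position_cases r with h | h | ⟨k, s, rfl, hs⟩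
  · refine ⟨⟨0, by omega, by omega, by omega, ?_⟩, ⟨4 - r, by omega, fun hf => ?_,
      fun t ht => ?_, ?_⟩⟩
    · rw [h0, add_zero, copySeq_of_lt h]
      omega
    · have := hf.1
      omega
    · rw [copySeq_of_lt (by omega), copySeq_of_lt (by omega)]
    · rw [show r + (4 - r) = 4 by omega, h4, copySeq_of_lt (by omega)]
      omega
  · have hr4 := h.1
    rcases Nat.mod_two_eq_zero_or_one r with hpar | hpar
    · have hz := copySeq_filler_even (M := M) h hpar
      have hz' := copySeq_succ_of_filler_even (M := M) h hpar
      refine ⟨⟨1, by omega, fun _ => le_rfl, fun t ht => ?_, ?_⟩, ⟨0, by omega, by omega,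
        by omega, ?_⟩⟩
      · obtain rfl : t = 0 := by omega
        rw [add_zero, hz, h0, Nat.sub_self]
      · rw [hz', h1]
        omega
      · rw [add_zero, hz, h0]
        omega
    · have hz := copySeq_filler_odd (M := M) h hpar
      have hz' := copySeq_succ_of_filler_odd (M := M) h hpar
      refine ⟨⟨0, by omega, by omega, by omega, ?_⟩, ⟨1, by omega, fun _ => le_rfl,
        fun t ht => ?_, ?_⟩⟩
      · rw [add_zero, hz, h0]
        omega
      · obtain rfl : t = 0 := by omega
        rw [add_zero, hz, h0]
      · rw [hz', h1]
        omega
  · obtain ⟨hp, hp'⟩ := sixteen_pow_add_two k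
    have hq : 16 ^ (k + 2) = 16 * 16 ^ (k + 1) := by ring
    have hnf : ¬ IsFiller (16 ^ (k + 2) + s) := by
      intro hf
      have hc := copySeq_copy (M := M) hs
      rcases hf.2 with h | ⟨l, u, heq, hu, hu'⟩
      · omega
      · have hl := log_sixteen_pow_add (k := k + 2) (s := s) (by omega)
        rw [heq, log_sixteen_pow_add hu'] at hl
        rw [hl] at heq hu
        omega
    have hF := isFiller_two_mul_pow k
    have hmid : IsFiller (16 ^ (k + 2) + (2 * 16 ^ (k + 1) + 1)) :=
      ⟨by omega, Or.inr ⟨k, _, rfl, by omega, by omega⟩⟩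
    have hmid1 : copySeq M (16 ^ (k + 2) + (2 * 16 ^ (k + 1) + 1)) = M :=
      copySeq_filler_odd hmid (by omega)
    have hFe := copySeq_filler_even (M := M) hF (by omega)
    have hFo := copySeq_succ_of_filler_even (M := M) hF (by omega)
    rcases Nat.eq_zero_or_pos s with rfl | hs0
    · refine ⟨⟨2 * 16 ^ (k + 1) + 1, by omega, fun hf => absurd hf hnf, fun t ht => ?_, ?_⟩,
        ⟨0, by omega, by omega, by omega, ?_⟩⟩
      · rw [add_zero, copySeq_copy (by omega)]
      · rw [add_zero, hmid1, hFo]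
        omega
      · rw [add_zero, add_zero, copySeq_pow, h0]
        omega
    · rcases eq_or_ne s (2 * 16 ^ (k + 1)) with rfl | hne
      · have hc := copySeq_copy (M := M) hs
        rw [hFe, Nat.sub_zero] at hc
        refine ⟨⟨0, by omega, by omega, by omega, ?_⟩,
          ⟨2, by omega, fun hf => absurd hf hnf, fun t ht => ?_, ?_⟩⟩
        · rw [add_zero, hc, h0]
          omega
        · interval_cases t
          · rw [add_zero, hc, h0]
          · rw [add_assoc, hmid1, h1]
        · rw [h2, add_assoc, show 16 ^ (k + 2) + (2 * 16 ^ (k + 1) + 2) =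
            16 ^ (k + 2) + (2 * 16 ^ (k + 1) + 1) + 1 by ring,
            copySeq_succ_of_filler_odd hmid (by omega)]
          omega
      · have hslt : s < 2 * 16 ^ (k + 1) := by omega
        obtain ⟨⟨i, hi, hif, hit, hlt⟩, ⟨j, hj, hjf, hjt, hlt'⟩⟩ := ih s (by omega) hs0
        have hsi := add_le_of_short hslt (by omega) hif
        have hsj := add_le_of_short hslt hj hjf
        refine ⟨⟨j, by omega, fun hf => absurd hf hnf, fun t ht => ?_, ?_⟩,
          ⟨i, by omega, fun hf => absurd hf hnf, fun t ht => ?_, ?_⟩⟩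
        · rw [add_assoc, copySeq_copy (by omega), hjt t ht]
        · rw [add_assoc, copySeq_copy (by omega)]
          have := copySeq_le M j
          omega
        · rw [add_assoc, copySeq_copy (by omega), hit t ht]
          have := copySeq_le M t
          omega
        · rw [add_assoc, copySeq_copy (by omega)]
          have := copySeq_le M (s + i)
          omega

/-- Membership in `V` from strict comparisons of all shifts that differ from the sequence. -/
theorem memV_of_compare {M : ℕ} {a : ℕ → ℕ} (ha : memSigma M a)
    (h : ∀ n, shift^[n] a = a ∨ (∃ i, (∀ t < i, a (n + t) = M - a t) ∧ M - a i < a (n + i)) ∧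
      ∃ i, (∀ t < i, a (n + t) = a t) ∧ a (n + i) < a i) (h0 : a 0 = M) (hM : 1 ≤ M) :
    memV M a := by
  refine ⟨ha, fun n => ?_⟩
  rcases h n with heq | ⟨⟨i, hi, hlt⟩, ⟨j, hj, hlt'⟩⟩
  · rw [heq]
    refine ⟨Or.inr ⟨0, by omega, ?_⟩, Or.inl rfl⟩
    simp only [reflSeq, h0]
    omega
  · refine ⟨Or.inr ⟨i, fun t ht => ?_, ?_⟩, Or.inr ⟨j, fun t ht => ?_, ?_⟩⟩
    · rw [shift_iterate_apply, hi t ht, reflSeq]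
    · rwa [shift_iterate_apply, reflSeq]
    · rw [shift_iterate_apply, hj t ht]
    · rwa [shift_iterate_apply]

theorem memV_copySeq {M : ℕ} (hM : 1 ≤ M) : memV M (copySeq M) := by
  refine memV_of_compare (copySeq_le M) (fun n => ?_) (copySeq_of_lt (by norm_num)) hM
  rcases Nat.eq_zero_or_pos n with rfl | hn
  · exact Or.inl rfl
  · obtain ⟨⟨i, -, -, hi, hlt⟩, ⟨j, -, -, hj, hlt'⟩⟩ := copySeq_compare hM n hn
    exact Or.inr ⟨⟨i, hi, hlt⟩, ⟨j, hj, hlt'⟩⟩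

theorem memV_lowerPer_copySeq {M : ℕ} (hM : 1 ≤ M) (k : ℕ) :
    memV M (lowerPer (copySeq M) (2 * 16 ^ (k + 1) + 1)) := by
  have hF := isFiller_two_mul_pow k
  have hFe := copySeq_filler_even (M := M) hF (by omega)
  have hFo := copySeq_succ_of_filler_even (M := M) hF (by omega)
  have h16 : 16 ≤ 16 ^ (k + 1) := Nat.le_self_pow (by omega) 16
  set n := 2 * 16 ^ (k + 1) + 1 with hn
  set b := lowerPer (copySeq M) n with hb
  have hlt : ∀ {i}, i < n → b i = copySeq M i := fun h => lowerPer_of_lt _ h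
  have hlast : b n = M - 1 := by rw [hb, lowerPer_self, hFo]
  have hpre : b (n - 1) = 0 := by rw [hlt (by omega), hn, Nat.add_sub_cancel, hFe]
  have hb4 : ∀ {i}, i < 4 → b i = M := fun h => by rw [hlt (by omega), copySeq_of_lt h]
  have hwrap : ∀ i, b (n + 1 + i) = b i := fun i => lowerPer_congr _ (by simp [Nat.ModEq])
  refine memV_of_compare (fun i => ?_) (fun m => ?_) (hb4 (by norm_num)) hM
  · rw [hb, ← lowerPer_mod, ← hb]
    rcases Nat.lt_succ_iff_lt_or_eq.1 (Nat.mod_lt i (Nat.succ_pos n)) with h | h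
    · rw [hlt h]
      exact copySeq_le M _
    · rw [h, hlast]
      omega
  · have hmod : m % (n + 1) < n + 1 := Nat.mod_lt _ (by omega)
    have hcong : ∀ i, b (m + i) = b (m % (n + 1) + i) := fun i =>
      lowerPer_congr _ (by simp [Nat.ModEq])
    simp only [hcong]
    have hshift : m % (n + 1) = 0 → shift^[m] b = b := by
      intro h
      ext i
      rw [shift_iterate_apply, hcong, h, zero_add]
    generalize m % (n + 1) = r at *
    rcases Nat.eq_zero_or_pos r with hr | hr
    · exact Or.inl (hshift hr)
    refine Or.inr ?_
    rcases lt_trichotomy r (n - 1) with hrn | rfl | hrn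
    · obtain ⟨⟨i, hi, hif, hit, hil⟩, ⟨j, hj, hjf, hjt, hjl⟩⟩ := copySeq_compare hM r hr
      have hsi := add_le_of_short (k := k) (by omega) (by omega) hif
      have hsj := add_le_of_short (k := k) (by omega) hj hjf
      refine ⟨⟨i, fun t ht => ?_, ?_⟩, ⟨j, fun t ht => ?_, ?_⟩⟩
      · rw [hlt (by omega), hlt (by omega), hit t ht]
      · rwa [hlt (by omega), hlt (by omega)]
      · rw [hlt (by omega), hlt (by omega), hjt t ht]
      · rwa [hlt (by omega), hlt (by omega)]
    · have e0 : b (n - 1 + 0) = 0 := hpre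
      have e1 : b (n - 1 + 1) = M - 1 := by rw [Nat.sub_add_cancel (by omega), hlast]
      have e2 : b (n - 1 + 2) = M := by
        rw [show n - 1 + 2 = n + 1 + 0 by omega, hwrap, hb4 (by norm_num)]
      have f0 : b 0 = M := hb4 (by norm_num)
      have f1 : b 1 = M := hb4 (by norm_num)
      have f2 : b 2 = M := hb4 (by norm_num)
      refine ⟨?_, 0, by omega, by omega⟩
      rcases eq_or_ne M 1 with hM1 | hM1
      · refine ⟨2, fun t ht => ?_, by omega⟩
        interval_cases t <;> omega
      · refine ⟨1, fun t ht => ?_, by omega⟩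
        obtain rfl : t = 0 := by omega
        omega
    · obtain rfl : n = r := by omega
      have e0 : b (n + 0) = M - 1 := hlast
      have e1 : b (n + 1) = M := by
        rw [← add_zero (n + 1), hwrap, hb4 (by norm_num)]
      have f0 : b 0 = M := hb4 (by norm_num)
      have f1 : b 1 = M := hb4 (by norm_num)
      refine ⟨?_, 0, by omega, by omega⟩
      rcases eq_or_ne M 1 with hM1 | hM1
      · refine ⟨1, fun t ht => ?_, by omega⟩
        obtain rfl : t = 0 := by omega
        omega
      · exact ⟨0, by omega, by omega⟩

/-- If the orbit of `α(q) ∈ V` meets arbitrarily long prefixes of its reflection, then the symmetric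
shift does not have the specification property. -/
theorem not_hasSpecification_of_copies {M : ℕ} (hM : 1 ≤ M) {q : ℝ} (hV : memV M (qg M q))
    (h0 : qg M q 0 = M) (hz : ∃ k, qg M q k = 0)
    (hcopy : ∀ K, ∃ n, ∀ t < K, qg M q (n + t) = M - qg M q t) :
    ¬ HasSpecification (Vq M q) := by
  rintro ⟨S, hS⟩
  set a := qg M q with ha
  obtain ⟨n, hn⟩ := hcopy (S + 1)
  have haV : a ∈ Vq M q := hV
  have hu : InLang (Vq M q) (prefixWord a n) := by
    refine ⟨a, haV, 0, fun i hi => ?_⟩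
    rw [length_prefixWord] at hi
    rw [zero_add, getD_prefixWord a hi]
  have hforced : ∀ c, InLang (Vq M q) [c] → c = M - a S := by
    intro c hc
    obtain ⟨w, hw, x, hx, k, hk⟩ := hS _ _ hu hc
    simp only [List.length_append, length_prefixWord, hw, List.length_singleton] at hk
    have hpre : ∀ i < n, x (k + i) = a i := by
      intro i hi
      rw [hk i (by omega), ← getD_prefixWord a hi, List.append_assoc,
        List.getD_append _ _ _ _ (by simpa using hi)]
    have hc' : x (k + (n + S)) = c := by
      rw [hk (n + S) (by omega), List.getD_append_right _ _ _ _ (by simp [hw])]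
      simp [hw]
    rw [← hc']
    have hle := (hx.2 k).2
    have hz := (hx.2 (k + n)).1
    rw [← ha] at hle hz
    rcases hz with heq | ⟨p, hp, hlt⟩
    · have := congrFun heq S
      rw [shift_iterate_apply, reflSeq] at this
      rw [this, add_assoc]
    · by_cases hpS : p ≤ S
      · refine absurd hle (not_lexLE_of_agree (n := n + p) (fun i hi => ?_) ?_)
        · rw [shift_iterate_apply]
          rcases lt_or_ge i n with hin | hin
          · exact hpre i hin
          · obtain ⟨t, rfl⟩ := Nat.exists_eq_add_of_le hin
            have := hp t (by omega)
            rw [shift_iterate_apply, reflSeq] at this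
            rw [hn t (by omega), this, add_assoc]
        · rw [shift_iterate_apply, hn p (by omega), ← add_assoc]
          rwa [shift_iterate_apply, reflSeq] at hlt
      · have := hp S (by omega)
        rw [shift_iterate_apply, reflSeq] at this
        rw [this, add_assoc]
  have hletter : ∀ k, InLang (Vq M q) [a k] := fun k =>
    ⟨a, haV, k, fun i hi => by
      obtain rfl : i = 0 := by simpa using hi
      rfl⟩
  obtain ⟨k, hk⟩ := hz
  have e1 := hforced _ (hletter 0)
  have e2 := hforced _ (hletter k)
  omega

theorem seqDist_le_of_agree {x y : ℕ → ℕ} {K : ℕ} (h : ∀ t < K, x t = y t) :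
    seqDist x y ≤ (1 / 2 : ℝ) ^ K := by
  rw [seqDist]
  split_ifs with hxy
  · positivity
  · have hne : {i : ℕ | x i ≠ y i}.Nonempty := by
      by_contra hcon
      rw [Set.not_nonempty_iff_eq_empty] at hcon
      exact hxy (funext fun i => by_contra fun hi => (hcon ▸ (show i ∈ {i | x i ≠ y i} from hi) :))
    have hK : K ≤ sInf {i : ℕ | x i ≠ y i} := le_csInf hne fun i hi => by
      by_contra hlt
      exact hi (h i (by omega))
    exact pow_le_pow_of_le_one (by norm_num) (by norm_num) (by omega)

/-- There is a strongly irreducible base whose symmetric shift fails the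
specification property; indeed one whose orbit of `α(q)` comes arbitrarily close to
`ᾱ(q)`. -/
theorem exists_SI_without_specification (M : ℕ) (hM : 1 ≤ M) :
    ∃ q : ℝ, memSI M q ∧ ¬ HasSpecification (Vq M q) ∧
      ∀ K : ℕ, ∃ n : ℕ,
        seqDist (shift^[n] (qg M q)) (reflSeq M (qg M q)) ≤ (1 / 2 : ℝ) ^ K := by
  have hV := memV_copySeq hM
  have h0 : copySeq M 0 = M := copySeq_of_lt (by norm_num)
  have h1 : copySeq M 1 = M := copySeq_of_lt (by norm_num)
  have hshort : ∀ r, 1 ≤ r → ∃ i, 4 * i ≤ r ∧ copySeq M (r + i) ≠ M - copySeq M i := fun r hr => by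
    obtain ⟨⟨i, hi, -, -, hlt⟩, -⟩ := copySeq_compare hM r hr
    exact ⟨i, hi, hlt.ne'⟩
  have hlarge : ∀ N, N < 2 * 16 ^ (N + 1) := fun N => by
    have := Nat.lt_pow_self (n := N + 1) (show 1 < 16 by norm_num)
    omega
  obtain ⟨q, hq1, hqM, hq⟩ := exists_qg_eq hM hV h0 fun N => by
    refine ⟨2 * 16 ^ (N + 1) + 1, by have := hlarge N; omega, ?_⟩
    rw [copySeq_succ_of_filler_even (isFiller_two_mul_pow N) (by omega)]
    omega
  have hcopy : ∀ K, ∃ n, ∀ t < K, copySeq M (n + t) = M - copySeq M t := fun K =>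
    ⟨16 ^ (K + 2), fun t ht => copySeq_copy (by
      have := hlarge K
      rw [pow_succ 16 (K + 1)]
      omega)⟩
  refine ⟨q, ⟨⟨⟨hq1, hqM, hq ▸ hV⟩, ?_⟩, 20, fun m hm => ?_⟩, ?_, fun K => ?_⟩
  · rw [hq]
    refine irreducibleSeq_of_mismatch hM hV h0 h1 fun j hj => ?_
    obtain ⟨i, hi, hne⟩ := hshort j (by omega)
    exact ⟨i, by omega, hne⟩
  · have happrox := memV_approxIdx (M := M) (q := q) (fun N => by
      rw [hq]
      exact ⟨2 * 16 ^ (N + 1) + 1 + 1, by have := hlarge N; omega,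
        memV_lowerPer_copySeq hM N⟩) m
    rw [approxBase]
    generalize approxIdx M q m = n at happrox
    obtain ⟨n, rfl⟩ : ∃ n', n = n' + 1 := ⟨n - 1, by omega⟩
    rw [hq] at happrox ⊢
    obtain ⟨hmn, hVn⟩ := happrox
    change memV M (lowerPer (copySeq M) n) at hVn
    change memI M (baseOf M (lowerPer (copySeq M) n))
    have hl0 : lowerPer (copySeq M) n 0 = M := by rw [lowerPer_of_lt _ (by omega), h0]
    obtain ⟨hb1, hbM, hb⟩ := baseOf_spec (exists_qg_eq hM hVn hl0 fun N =>
      ⟨(n + 1) * N, Nat.le_mul_of_pos_left N (by omega), by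
        rw [lowerPer_congr (j := 0) _ (by simp [Nat.ModEq]), hl0]
        omega⟩)
    refine ⟨⟨hb1, hbM, ?_⟩, ?_⟩
    · rwa [hb]
    · rw [hb]
      exact irreducibleSeq_lowerPer hM h0 h1 hshort (by omega) hVn
  · refine not_hasSpecification_of_copies hM (hq ▸ hV) (by rw [hq, h0]) ⟨256, ?_⟩ (by rwa [hq])
    rw [hq]
    exact copySeq_pow M 0
  · obtain ⟨n, hn⟩ := hcopy K
    refine ⟨n, seqDist_le_of_agree fun t ht => ?_⟩
    rw [shift_iterate_apply, hq, hn t ht, reflSeq]
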